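/- Let E = {1,...,n} and let 𝒞 be a collection of subsets of E satisfying (C1) ∅ ∉ 𝒞 and (C2) no member of 𝒞 is a proper subset of another. Then 𝒞 satisfies the circuit elimination axiom (C3) — for all distinct C1, C2 ∈ 𝒞 and every e ∈ C1 ∩ C2 there exists C3 ∈ 𝒞 with C3 ⊆ (C1 ∪ C2) \ {e} — if and only if 𝒞 has the no-tie property: for every bijection σ : {1,...,n} → E, if 𝒞 is nonempty then there is a unique C ∈ 𝒞 achieving the minimum of t_C(σ) over all C ∈ 𝒞, where t_C(σ) = min{t : C ⊆ σ({1,...,t})}. -/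

import Mathlib

open Finset

/-- A matroid presented by its collection of circuits (the valid sets of bingo
cards): nonempty ground set axioms (C1)-(C3) of the paper. -/
structure BingoMatroid (α : Type*) [DecidableEq α] where
  /-- the ground set -/
  E : Finset α
  /-- the circuits (bingo cards) -/
  circuits : Finset (Finset α)
  subset_ground : ∀ C ∈ circuits, C ⊆ E
  empty_not_mem : ∅ ∉ circuits
  antichain : ∀ C₁ ∈ circuits, ∀ C₂ ∈ circuits, C₁ ⊆ C₂ → C₁ = C₂
  elimination : ∀ C₁ ∈ circuits, ∀ C₂ ∈ circuits, C₁ ≠ C₂ →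
    ∀ e ∈ C₁ ∩ C₂, ∃ C₃ ∈ circuits, C₃ ⊆ (C₁ ∪ C₂) \ {e}

/-- The completion time `t_C(σ)`: the least `t` such that every element of `C`
has been called out among the first `t` values of `σ`. -/
noncomputable def hitTime {α : Type*} {n : ℕ} (σ : Fin n → α) (C : Finset α) : ℕ :=
  sInf {t : ℕ | ∀ x ∈ C, ∃ i : Fin n, (i : ℕ) < t ∧ σ i = x}

namespace BingoMatroid

variable {α : Type*} [DecidableEq α]

/-- `C` wins the bingo game under calling order `σ`: it is completed strictly
before every other circuit. -/
def Wins (M : BingoMatroid α) (σ : Fin M.E.card ≃ {x // x ∈ M.E}) (C : Finset α) : Prop :=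
  ∀ C' ∈ M.circuits, C' ≠ C →
    hitTime (fun i => (σ i : α)) C < hitTime (fun i => (σ i : α)) C'

/-- The winning probability `β_C`: the number of calling orders under which `C`
wins, divided by `n!`. -/
noncomputable def beta (M : BingoMatroid α) (C : Finset α) : ℚ :=
  (Nat.card {σ : Fin M.E.card ≃ {x // x ∈ M.E} // M.Wins σ C} : ℚ) /
    (Nat.factorial M.E.card : ℚ)

/-- The timed winning probability `β_C(t)`: the probability that `C` wins and is
completed exactly in round `t`. -/
noncomputable def betaT (M : BingoMatroid α) (C : Finset α) (t : ℕ) : ℚ :=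
  (Nat.card {σ : Fin M.E.card ≃ {x // x ∈ M.E} //
      M.Wins σ C ∧ hitTime (fun i => (σ i : α)) C = t} : ℚ) /
    (Nat.factorial M.E.card : ℚ)

/-- A set is independent if it is contained in the ground set and contains no circuit. -/
def Indep (M : BingoMatroid α) (I : Finset α) : Prop :=
  I ⊆ M.E ∧ ∀ C ∈ M.circuits, ¬ C ⊆ I

/-- The rank of the matroid: the maximum size of an independent set. -/
noncomputable def rank (M : BingoMatroid α) : ℕ :=
  sSup {k : ℕ | ∃ I : Finset α, M.Indep I ∧ I.card = k}

/-- A basis is a maximal independent set. -/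
def IsBase (M : BingoMatroid α) (B : Finset α) : Prop :=
  M.Indep B ∧ ∀ J : Finset α, M.Indep J → B ⊆ J → B = J

/-- A coloop is an element of the ground set contained in no circuit. -/
def IsColoop (M : BingoMatroid α) (e : α) : Prop :=
  e ∈ M.E ∧ ∀ C ∈ M.circuits, e ∉ C

/-- `D` is a circuit of the contraction `M/T`: a nonempty inclusion-minimal
member of `{C \ T : C a circuit of M}`. -/
def IsContractCircuit (M : BingoMatroid α) (T D : Finset α) : Prop :=
  D.Nonempty ∧ (∃ C ∈ M.circuits, D = C \ T) ∧
    ∀ C' ∈ M.circuits, (C' \ T).Nonempty → ¬ (C' \ T) ⊂ D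

end BingoMatroid

theorem hitTime_le_iff {α : Type*} {n : ℕ} (σ : Fin n ≃ α) (C : Finset α) (t : ℕ) :
    hitTime σ C ≤ t ↔ ∀ x ∈ C, (σ.symm x : ℕ) < t := by
  have hmem : ∀ s : ℕ, s ∈ {t : ℕ | ∀ x ∈ C, ∃ i : Fin n, (i : ℕ) < t ∧ σ i = x} ↔
      ∀ x ∈ C, (σ.symm x : ℕ) < s := by
    intro s
    refine forall₂_congr fun x _ => ⟨?_, fun h => ⟨σ.symm x, h, σ.apply_symm_apply x⟩⟩
    rintro ⟨i, hi, rfl⟩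
    simpa using hi
  constructor
  · intro h x hx
    have hmin : hitTime σ C ∈ {t : ℕ | ∀ x ∈ C, ∃ i : Fin n, (i : ℕ) < t ∧ σ i = x} :=
      Nat.sInf_mem ⟨n, (hmem n).2 fun x _ => (σ.symm x).isLt⟩
    exact ((hmem _).1 hmin x hx).trans_le h
  · intro h
    exact Nat.sInf_le ((hmem t).2 h)

/-- The element called in the round in which a nonempty card is completed lies on that card. -/
theorem exists_mem_symm_add_one_eq_hitTime {α : Type*} {n : ℕ} (σ : Fin n ≃ α) {C : Finset α}
    (hC : C.Nonempty) : ∃ x ∈ C, (σ.symm x : ℕ) + 1 = hitTime σ C := by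
  obtain ⟨x, hx, hmax⟩ := C.exists_max_image (fun x => (σ.symm x : ℕ)) hC
  refine ⟨x, hx, le_antisymm ((hitTime_le_iff σ C _).1 le_rfl x hx) ?_⟩
  exact (hitTime_le_iff σ C _).2 fun y hy => Nat.lt_succ_of_le (hmax y hy)

/-- Some calling order calls `U \ {e}` first, then `e`, then everything else. -/
theorem exists_perm_calling_last {n : ℕ} (U : Finset (Fin n)) (e : Fin n) :
    ∃ σ : Equiv.Perm (Fin n), (∀ x ∈ U, σ.symm x ≤ σ.symm e) ∧
      ∀ x, σ.symm x < σ.symm e → x ∈ U \ {e} := by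
  let f : Fin n → ℕ := fun x => if x = e then 1 else if x ∈ U then 0 else 2
  have hmono : ∀ x y, (Tuple.sort f).symm x ≤ (Tuple.sort f).symm y → f x ≤ f y := by
    intro x y h
    simpa using Tuple.monotone_sort f h
  have hfe : f e = 1 := if_pos rfl
  refine ⟨Tuple.sort f, fun x hx => ?_, fun x hx => ?_⟩
  · by_contra! h
    have hne : x ≠ e := by rintro rfl; exact h.false
    have hle := hmono _ _ h.le
    simp [f, hne, hx] at hle
  · have hne : x ≠ e := by rintro rfl; exact hx.false
    have hle := hmono _ _ hx.le
    by_contra hxU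
    simp_all [f]

/-- for a collection of subsets of `{1,...,n}` satisfying (C1)
and (C2), the circuit elimination axiom (C3) holds iff the bingo game has the
no-tie property: for every calling order there is a unique first-completed card. -/
theorem stmt19 (n : ℕ) (𝒞 : Finset (Finset (Fin n)))
    (hC1 : ∅ ∉ 𝒞)
    (hC2 : ∀ C₁ ∈ 𝒞, ∀ C₂ ∈ 𝒞, C₁ ⊆ C₂ → C₁ = C₂) :
    (∀ C₁ ∈ 𝒞, ∀ C₂ ∈ 𝒞, C₁ ≠ C₂ → ∀ e ∈ C₁ ∩ C₂, ∃ C₃ ∈ 𝒞, C₃ ⊆ (C₁ ∪ C₂) \ {e}) ↔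
    (∀ σ : Equiv.Perm (Fin n), 𝒞.Nonempty →
      ∃! C, C ∈ 𝒞 ∧ ∀ C' ∈ 𝒞, hitTime (⇑σ) C ≤ hitTime (⇑σ) C') := by
  constructor
  · intro hC3 σ hne
    obtain ⟨C, hC, hmin⟩ := 𝒞.exists_min_image (fun C => hitTime σ C) hne
    refine ⟨C, ⟨hC, hmin⟩, ?_⟩
    rintro D ⟨hD, hDmin⟩
    by_contra hDC
    have hnonempty : ∀ A ∈ 𝒞, A.Nonempty := fun A hA =>
      nonempty_iff_ne_empty.2 fun h => hC1 (h ▸ hA)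
    have heq : hitTime σ C = hitTime σ D := le_antisymm (hmin D hD) (hDmin C hC)
    obtain ⟨x, hx, hxt⟩ := exists_mem_symm_add_one_eq_hitTime σ (hnonempty C hC)
    obtain ⟨y, hy, hyt⟩ := exists_mem_symm_add_one_eq_hitTime σ (hnonempty D hD)
    obtain rfl : x = y := σ.symm.injective (Fin.ext (by omega))
    obtain ⟨A, hA, hAsub⟩ := hC3 D hD C hC hDC x (mem_inter.2 ⟨hy, hx⟩)
    have hAle : hitTime σ A ≤ (σ.symm x : ℕ) := by
      refine (hitTime_le_iff σ A _).2 fun z hz => ?_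
      obtain ⟨hzU, hzx⟩ := mem_sdiff.1 (hAsub hz)
      have hzlt : (σ.symm z : ℕ) < hitTime σ C := by
        rcases mem_union.1 hzU with h | h
        · exact heq ▸ (hitTime_le_iff σ D _).1 le_rfl z h
        · exact (hitTime_le_iff σ C _).1 le_rfl z h
      have hzne : (σ.symm z : ℕ) ≠ σ.symm x := fun h =>
        hzx (mem_singleton.2 (σ.symm.injective (Fin.ext h)))
      omega
    have hCA : hitTime σ C ≤ hitTime σ A := hmin A hA
    omega
  · intro hties C₁ h₁ C₂ h₂ hne e he
    by_contra! hno
    obtain ⟨σ, hle, hlt⟩ := exists_perm_calling_last (C₁ ∪ C₂) e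
    have hlower : ∀ C ∈ 𝒞, (σ.symm e : ℕ) + 1 ≤ hitTime σ C := by
      intro C hC
      by_contra! h
      exact hno C hC fun x hx =>
        hlt x ((hitTime_le_iff σ C _).1 (Nat.lt_succ_iff.1 h) x hx)
    have hupper : ∀ C, C ⊆ C₁ ∪ C₂ → hitTime σ C ≤ (σ.symm e : ℕ) + 1 := fun C hC =>
      (hitTime_le_iff σ C _).2 fun x hx => Nat.lt_succ_of_le (hle x (hC hx))
    exact hne ((hties σ ⟨C₁, h₁⟩).unique
      ⟨h₁, fun C hC => (hupper C₁ subset_union_left).trans (hlower C hC)⟩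
      ⟨h₂, fun C hC => (hupper C₂ subset_union_right).trans (hlower C hC)⟩)
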